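/- arXiv:1011.4868 — 5 statements merged into one kernel-verified Lean document; each statement's English description precedes it below -/
import Mathlib

section
/- For all natural numbers j ≠ k, the rescaled Hermite polynomials are orthogonal with respect to the Gaussian weight e^{−σ²/4}: the integral ∫_ℝ h_j(σ)·h_k(σ)·e^{−σ²/4} dσ equals 0. -/
open MeasureTheory

/-- The rescaled Hermite polynomial `h_k(σ) = 2^(k/2) · He_k(σ/√2)`, as a function. -/
noncomputable def rescaledHermiteFun (k : ℕ) (σ : ℝ) : ℝ :=
  (2 : ℝ) ^ ((k : ℝ) / 2) * Polynomial.aeval (σ / Real.sqrt 2) (Polynomial.hermite k)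

theorem aux_integrable (p : Polynomial ℤ) :
    Integrable fun x : ℝ => Polynomial.aeval x p * Real.exp (-(x ^ 2 / 2)) := by
  induction p using Polynomial.induction_on' with
  | add p q hp hq =>
    refine (hp.add hq).congr (Filter.Eventually.of_forall fun x => ?_)
    simp [add_mul]
  | monomial n a =>
    have h := integrable_rpow_mul_exp_neg_mul_sq (b := 1 / 2) (by norm_num) (s := n)
      (by have : (0 : ℝ) ≤ n := n.cast_nonneg
          linarith)
    refine (h.const_mul (a : ℝ)).congr (Filter.Eventually.of_forall fun x => ?_)
    simp only [Real.rpow_natCast, Polynomial.aeval_monomial, algebraMap_int_eq, eq_intCast]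
    rw [show -(1 / 2) * x ^ 2 = -(x ^ 2 / 2) by ring]
    ring

theorem aux_orth (k : ℕ) : ∀ p : Polynomial ℤ, Polynomial.derivative^[k] p = 0 →
    ∫ x : ℝ, Polynomial.aeval x (p * Polynomial.hermite k) * Real.exp (-(x ^ 2 / 2)) = 0 := by
  induction k with
  | zero =>
    intro p hp
    simp only [Function.iterate_zero, id] at hp
    simp [hp]
  | succ k ih =>
    intro p hp
    have h := ih (Polynomial.derivative p) (by simpa using hp)
    have key := integral_mul_deriv_eq_deriv_mul_of_integrable
      (u := fun x : ℝ => Polynomial.aeval x p)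
      (u' := fun x : ℝ => Polynomial.aeval x (Polynomial.derivative p))
      (v := fun x : ℝ => Polynomial.aeval x (Polynomial.hermite k) * Real.exp (-(x ^ 2 / 2)))
      (v' := fun x : ℝ => Polynomial.aeval x (-Polynomial.hermite (k + 1)) *
        Real.exp (-(x ^ 2 / 2)))
      (fun x _ => p.hasDerivAt_aeval x)
      (fun x _ => by
        have h1 := (Polynomial.hermite k).hasDerivAt_aeval x
        have h2 : HasDerivAt (fun x : ℝ => Real.exp (-(x ^ 2 / 2)))
            (Real.exp (-(x ^ 2 / 2)) * (-x)) x := by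
          have h3 : HasDerivAt (fun x : ℝ => -(x ^ 2 / 2)) (-x) x := by
            convert! ((hasDerivAt_pow 2 x).div_const 2).neg using 1
            simp
          exact h3.exp
        convert! h1.mul h2 using 1
        rw [Polynomial.hermite_succ]
        simp only [map_neg, map_sub, map_mul, Polynomial.aeval_X]
        ring)
      ((aux_integrable (p * -Polynomial.hermite (k + 1))).congr
        (Filter.Eventually.of_forall fun x => by simp [mul_assoc]))
      ((aux_integrable (Polynomial.derivative p * Polynomial.hermite k)).congr
        (Filter.Eventually.of_forall fun x => by simp [mul_assoc]))
      ((aux_integrable (p * Polynomial.hermite k)).congr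
        (Filter.Eventually.of_forall fun x => by simp [mul_assoc]))
    simp only [map_mul, map_neg, neg_mul, mul_neg, integral_neg, neg_inj, ← mul_assoc] at key h ⊢
    rw [key, h]

theorem aux_lt (j k : ℕ) (hjk : j < k) :
    ∫ σ : ℝ, rescaledHermiteFun j σ * rescaledHermiteFun k σ * Real.exp (-σ ^ 2 / 4) = 0 := by
  have h := aux_orth k (Polynomial.hermite j)
    (Polynomial.iterate_derivative_eq_zero (by simpa using hjk))
  have h2 := Measure.integral_comp_div (fun x : ℝ => Polynomial.aeval x
    (Polynomial.hermite j * Polynomial.hermite k) * Real.exp (-(x ^ 2 / 2))) (Real.sqrt 2)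
  rw [h, smul_zero] at h2
  have h3 : ∀ σ : ℝ, rescaledHermiteFun j σ * rescaledHermiteFun k σ * Real.exp (-σ ^ 2 / 4) =
      ((2 : ℝ) ^ ((j : ℝ) / 2) * (2 : ℝ) ^ ((k : ℝ) / 2)) *
      (Polynomial.aeval (σ / Real.sqrt 2) (Polynomial.hermite j * Polynomial.hermite k) *
        Real.exp (-((σ / Real.sqrt 2) ^ 2 / 2))) := by
    intro σ
    have h4 : -((σ / Real.sqrt 2) ^ 2 / 2) = -σ ^ 2 / 4 := by
      rw [div_pow, Real.sq_sqrt (by norm_num)]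
      ring
    rw [h4, map_mul]
    unfold rescaledHermiteFun
    ring
  simp_rw [h3]
  rw [integral_const_mul, h2, mul_zero]

/-- The rescaled Hermite polynomials `h_j`, `h_k` with `j ≠ k` are orthogonal in
`L²(ℝ, e^{-σ²/4} dσ)`. -/
theorem rescaledHermite_orthogonal (j k : ℕ) (hjk : j ≠ k) :
    ∫ σ : ℝ, rescaledHermiteFun j σ * rescaledHermiteFun k σ * Real.exp (-σ ^ 2 / 4) = 0 := by
  rcases lt_or_gt_of_ne hjk with h | h
  · exact aux_lt j k h
  · simp_rw [mul_comm (rescaledHermiteFun j _)]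
    exact aux_lt k j h
end

section
/- Fix an integer n ≥ 2 and a real number b₂. Let p(r) := 1 + b₂·r² + (n/(n+3))·b₂²·r⁴ + (n(n−1)/((n+3)(n+5)))·b₂³·r⁶. Then F[p](r) = O(r⁶) as r → 0⁺; that is, there exist constants C > 0 and δ > 0 such that |F[p](r)| ≤ C·r⁶ for all 0 < r < δ. In particular the truncated series 1 + b₂r² + (n/(n+3))b₂²r⁴ + (n(n−1)/((n+3)(n+5)))b₂³r⁶ solves the Bryant soliton equation F[z] = 0 to the stated order near r = 0. -/
/-- The Bryant soliton profile operator
`F[z](r) = z z'' - (1/2)(z')² + (n-1-z) z'/r + 2(n-1)(1-z) z/r²`. -/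
noncomputable def bryantOp (n : ℕ) (z : ℝ → ℝ) (r : ℝ) : ℝ :=
  z r * deriv (deriv z) r - (1 / 2) * (deriv z r) ^ 2
    + ((n : ℝ) - 1 - z r) * deriv z r / r
    + 2 * ((n : ℝ) - 1) * (1 - z r) * z r / r ^ 2

lemma bryant_deriv (a c d : ℝ) :
    deriv (fun r : ℝ => 1 + a * r ^ 2 + c * r ^ 4 + d * r ^ 6)
      = fun r => 2 * a * r + 4 * c * r ^ 3 + 6 * d * r ^ 5 := by
  funext r
  have h := ((((hasDerivAt_pow 2 r).const_mul a).const_add 1).add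
    ((hasDerivAt_pow 4 r).const_mul c)).add ((hasDerivAt_pow 6 r).const_mul d)
  refine (HasDerivAt.deriv h).trans ?_
  norm_num
  ring

lemma bryant_deriv_two (a c d : ℝ) :
    deriv (fun r : ℝ => 2 * a * r + 4 * c * r ^ 3 + 6 * d * r ^ 5)
      = fun r => 2 * a + 12 * c * r ^ 2 + 30 * d * r ^ 4 := by
  funext r
  have h := (((hasDerivAt_id r).const_mul (2 * a)).add
    ((hasDerivAt_pow 3 r).const_mul (4 * c))).add ((hasDerivAt_pow 5 r).const_mul (6 * d))
  refine (HasDerivAt.deriv h).trans ?_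
  norm_num
  ring

lemma bryant_value (n : ℕ) (a c d r : ℝ) (hr : r ≠ 0)
    (h1 : ((n : ℝ) + 3) * c = n * a ^ 2) (h2 : ((n : ℝ) + 5) * d = (n - 1) * a * c) :
    bryantOp n (fun r : ℝ => 1 + a * r ^ 2 + c * r ^ 4 + d * r ^ 6) r
      = r ^ 6 * ((12 * a * d - 4 * (n - 1) * a * d - 2 * (n - 1) * c ^ 2)
        + (8 - 4 * (n - 1)) * c * d * r ^ 2 + (6 - 2 * (n - 1)) * d ^ 2 * r ^ 4) := by
  unfold bryantOp
  rw [bryant_deriv, bryant_deriv_two]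
  field_simp
  linear_combination (4 * r ^ 4) * h1 + (8 * r ^ 6) * h2

/-- The truncated expansion
`p(r) = 1 + b₂ r² + (n/(n+3)) b₂² r⁴ + (n(n-1)/((n+3)(n+5))) b₂³ r⁶`
satisfies `F[p](r) = O(r⁶)` as `r → 0⁺`. -/
theorem bryant_expansion_at_origin (n : ℕ) (hn : 2 ≤ n) (b₂ : ℝ) :
    ∃ C > (0 : ℝ), ∃ δ > (0 : ℝ), ∀ r : ℝ, 0 < r → r < δ →
      |bryantOp n
          (fun r' => 1 + b₂ * r' ^ 2 + ((n : ℝ) / ((n : ℝ) + 3)) * b₂ ^ 2 * r' ^ 4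
            + ((n : ℝ) * ((n : ℝ) - 1) / (((n : ℝ) + 3) * ((n : ℝ) + 5))) * b₂ ^ 3 * r' ^ 6)
          r|
        ≤ C * r ^ 6 := by
  set c : ℝ := ((n : ℝ) / ((n : ℝ) + 3)) * b₂ ^ 2 with hc
  set d : ℝ := ((n : ℝ) * ((n : ℝ) - 1) / (((n : ℝ) + 3) * ((n : ℝ) + 5))) * b₂ ^ 3 with hd
  have h3 : (n : ℝ) + 3 ≠ 0 := by positivity
  have h5 : (n : ℝ) + 5 ≠ 0 := by positivity
  have h1 : ((n : ℝ) + 3) * c = n * b₂ ^ 2 := by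
    rw [hc]; field_simp
  have h2 : ((n : ℝ) + 5) * d = (n - 1) * b₂ * c := by
    rw [hc, hd]; field_simp
  set A : ℝ := 12 * b₂ * d - 4 * (n - 1) * b₂ * d - 2 * (n - 1) * c ^ 2 with hA
  set B : ℝ := (8 - 4 * (n - 1)) * c * d with hB
  set D : ℝ := (6 - 2 * (n - 1)) * d ^ 2 with hD
  refine ⟨|A| + |B| + |D| + 1, by positivity, 1, one_pos, fun r hr hr1 => ?_⟩
  rw [bryant_value n b₂ c d r hr.ne' h1 h2, abs_mul, abs_of_pos (pow_pos hr 6), mul_comm]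
  refine mul_le_mul_of_nonneg_right ?_ (pow_pos hr 6).le
  have e2 : r ^ 2 ≤ 1 := pow_le_one₀ hr.le hr1.le
  have e4 : r ^ 4 ≤ 1 := pow_le_one₀ hr.le hr1.le
  have k2 : |B * r ^ 2| ≤ |B| := by
    rw [abs_mul, abs_of_pos (pow_pos hr 2)]
    exact mul_le_of_le_one_right (abs_nonneg _) e2
  have k4 : |D * r ^ 4| ≤ |D| := by
    rw [abs_mul, abs_of_pos (pow_pos hr 4)]
    exact mul_le_of_le_one_right (abs_nonneg _) e4
  have := abs_add_three A (B * r ^ 2) (D * r ^ 4)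
  linarith
end

section
/- Fix an integer n ≥ 2. Let q(r) := r^{−2} + ((4−n)/(n−1))·r^{−4} + ((n−4)(n−7)/(n−1)²)·r^{−6}. Then F[q](r) = O(r^{−8}) as r → ∞; that is, there exist constants C > 0 and R > 0 such that |F[q](r)| ≤ C·r^{−8} for all r > R. In particular the truncated series r^{−2} + ((4−n)/(n−1))r^{−4} + ((n−4)(n−7)/(n−1)²)r^{−6} solves the Bryant soliton equation F[z] = 0 to the stated order near r = ∞ (this is the expansion with normalization c₂ = 1). -/
theorem bryant_hasDerivAt_aux (c : ℝ) (k : ℕ) (r : ℝ) (hr : r ≠ 0) :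
    HasDerivAt (fun x : ℝ => c / x ^ (k + 1)) (-((k : ℝ) + 1) * c / r ^ (k + 2)) r := by
  have h := (hasDerivAt_const r c).div (hasDerivAt_pow (k + 1) r) (pow_ne_zero _ hr)
  refine h.congr_deriv ?_
  push_cast
  field_simp
  ring

theorem bryant_deriv_aux (a b r : ℝ) (hr : r ≠ 0) :
    deriv (fun x : ℝ => 1 / x ^ 2 + a / x ^ 4 + b / x ^ 6) r
      = (-2) / r ^ 3 + (-4 * a) / r ^ 5 + (-6 * b) / r ^ 7 := by
  have h := ((bryant_hasDerivAt_aux 1 1 r hr).add (bryant_hasDerivAt_aux a 3 r hr)).add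
    (bryant_hasDerivAt_aux b 5 r hr)
  refine (HasDerivAt.deriv (h.congr_deriv ?_))
  norm_num

theorem bryant_deriv2_aux (a b r : ℝ) (hr : r ≠ 0) :
    deriv (deriv (fun x : ℝ => 1 / x ^ 2 + a / x ^ 4 + b / x ^ 6)) r
      = 6 / r ^ 4 + 20 * a / r ^ 6 + 42 * b / r ^ 8 := by
  have he : deriv (fun x : ℝ => 1 / x ^ 2 + a / x ^ 4 + b / x ^ 6) =ᶠ[nhds r]
      fun x => (-2) / x ^ 3 + (-4 * a) / x ^ 5 + (-6 * b) / x ^ 7 := by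
    filter_upwards [isOpen_ne.mem_nhds hr] with x hx
    exact bryant_deriv_aux a b x hx
  rw [he.deriv_eq]
  have h := ((bryant_hasDerivAt_aux (-2) 2 r hr).add (bryant_hasDerivAt_aux (-4 * a) 4 r hr)).add
    (bryant_hasDerivAt_aux (-6 * b) 6 r hr)
  refine (HasDerivAt.deriv (h.congr_deriv ?_))
  norm_num
  ring

theorem bryant_bound_aux (c r : ℝ) (k : ℕ) (hr : 1 < r) : |c / r ^ k| ≤ |c| := by
  rw [abs_div, abs_of_pos (by positivity : (0 : ℝ) < r ^ k)]
  exact div_le_self (abs_nonneg _) (one_le_pow₀ hr.le)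

/-- The truncated expansion
`q(r) = r⁻² + ((4-n)/(n-1)) r⁻⁴ + ((n-4)(n-7)/(n-1)²) r⁻⁶`
satisfies `F[q](r) = O(r⁻⁸)` as `r → ∞` (normalization `c₂ = 1`). -/
theorem bryant_expansion_at_infinity (n : ℕ) (hn : 2 ≤ n) :
    ∃ C > (0 : ℝ), ∃ R > (0 : ℝ), ∀ r : ℝ, R < r →
      |bryantOp n
          (fun r' => 1 / r' ^ 2 + ((4 - (n : ℝ)) / ((n : ℝ) - 1)) / r' ^ 4
            + (((n : ℝ) - 4) * ((n : ℝ) - 7) / ((n : ℝ) - 1) ^ 2) / r' ^ 6)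
          r|
        ≤ C / r ^ 8 := by
  have hn' : (2 : ℝ) ≤ n := by exact_mod_cast hn
  have hm : (n : ℝ) - 1 ≠ 0 := by linarith
  have ha : ((n : ℝ) - 1) * ((4 - (n : ℝ)) / ((n : ℝ) - 1)) = 4 - n := by field_simp
  generalize (4 - (n : ℝ)) / ((n : ℝ) - 1) = a at *
  generalize ((n : ℝ) - 4) * ((n : ℝ) - 7) / ((n : ℝ) - 1) ^ 2 = b
  obtain ⟨m, hmn⟩ : ∃ m : ℝ, m = (n : ℝ) - 1 := ⟨_, rfl⟩
  have ha' : m * a = 3 - m := by rw [hmn, ha]; ring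
  refine ⟨|24 * a - 4 * m * a - 4 * m * b| + |b * (44 - 4 * m) + a ^ 2 * (16 - 2 * m)|
    + |(48 - 4 * m) * (a * b)| + |b ^ 2 * (30 - 2 * m)| + 1, by positivity, 1, one_pos, ?_⟩
  intro r hr
  have hr0 : r ≠ 0 := by linarith
  have key : bryantOp n (fun r' => 1 / r' ^ 2 + a / r' ^ 4 + b / r' ^ 6) r
      = ((24 * a - 4 * m * a - 4 * m * b)
        + (b * (44 - 4 * m) + a ^ 2 * (16 - 2 * m)) / r ^ 2
        + ((48 - 4 * m) * (a * b)) / r ^ 4 + (b ^ 2 * (30 - 2 * m)) / r ^ 6) / r ^ 8 := by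
    unfold bryantOp
    rw [bryant_deriv2_aux a b r hr0, bryant_deriv_aux a b r hr0, ← hmn]
    field_simp
    linear_combination (-4 * r ^ 8) * ha'
  rw [key, abs_div, abs_of_pos (by positivity : (0 : ℝ) < r ^ 8)]
  gcongr
  have h1 := bryant_bound_aux (b * (44 - 4 * m) + a ^ 2 * (16 - 2 * m)) r 2 hr
  have h2 := bryant_bound_aux ((48 - 4 * m) * (a * b)) r 4 hr
  have h3 := bryant_bound_aux (b ^ 2 * (30 - 2 * m)) r 6 hr
  refine (abs_add_le _ _).trans ?_
  refine (add_le_add_left ((abs_add_le _ _).trans (add_le_add_left (abs_add_le _ _) _)) _).trans ?_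
  linarith
end

section
/- For every integer n ≥ 2 there exists a smooth function B : (0, ∞) → (0, 1) (the Bryant soliton profile function) such that: (i) F[B](r) = 0 for all r > 0; (ii) lim_{r→0⁺} B(r) = 1 and lim_{r→∞} B(r) = 0; and (iii) B is strictly monotone decreasing on (0, ∞). -/
namespace BryantAux

open Set Filter Topology

/-- The monotone nonlinearity. -/
noncomputable def G (n : ℕ) (x w : ℝ) : ℝ :=
  w * (1 - 3 / (1 + |x|)) / 2 + 2 - ((n : ℝ) - 1) * (1 - 2 / w) * (1 + |x|) + n * (1 + |x|) * w

lemma G_mono (n : ℕ) (hn : 2 ≤ n) (x v w : ℝ) (hv : 2 ≤ v) (hvw : v ≤ w) :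
    G n x v ≤ G n x w := by
  have hn' : (2 : ℝ) ≤ n := by exact_mod_cast hn
  unfold G
  set t := |x| with ht
  have ht0 : 0 ≤ t := abs_nonneg x
  have hv0 : 0 < v := by linarith
  have hw0 : 0 < w := by linarith
  have h1 : 2 / v - 2 / w ≤ (w - v) / 2 := by
    rw [div_sub_div _ _ hv0.ne' hw0.ne', div_le_div_iff₀ (by positivity) (by norm_num)]
    have : 4 ≤ v * w := by nlinarith
    nlinarith
  have h2 : 3 / (1 + t) ≤ 3 := by
    rw [div_le_iff₀ (by positivity)]; linarith
  have h3 : ((n : ℝ) - 1) * (1 + t) * (2 / v - 2 / w) ≤ ((n : ℝ) - 1) * (1 + t) * ((w - v) / 2) :=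
    mul_le_mul_of_nonneg_left h1 (by apply mul_nonneg <;> linarith)
  have h4 : 0 ≤ (w - v) * (3 - 3 / (1 + t)) := mul_nonneg (by linarith) (by linarith)
  have h5 : 0 ≤ (w - v) * (((n : ℝ) + 1) * (1 + t) / 2 - 1) := by
    apply mul_nonneg (by linarith)
    nlinarith
  nlinarith

lemma G_two (n : ℕ) (x : ℝ) : 2 * (n * (1 + |x|)) ≤ G n x 2 := by
  unfold G
  have ht0 : 0 ≤ |x| := abs_nonneg x
  have h2 : 3 / (1 + |x|) ≤ 3 := by
    rw [div_le_iff₀ (by positivity)]; linarith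
  norm_num
  linarith

lemma G_eight (n : ℕ) (hn : 2 ≤ n) (x : ℝ) : G n x 8 ≤ 8 * (n * (1 + |x|)) := by
  have hn' : (2 : ℝ) ≤ n := by exact_mod_cast hn
  unfold G
  have ht0 : 0 ≤ |x| := abs_nonneg x
  have h2 : 6 - 3 / 4 * (1 + |x|) ≤ 12 / (1 + |x|) := by
    rw [le_div_iff₀ (by positivity)]; nlinarith [sq_nonneg (|x| - 3)]
  have h3 : 12 / (1 + |x|) = 4 * (3 / (1 + |x|)) := by ring
  nlinarith

lemma G_bounds (n : ℕ) (hn : 2 ≤ n) (x w : ℝ) (hw : w ∈ Icc (2 : ℝ) 8) :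
    2 * (n * (1 + |x|)) ≤ G n x w ∧ G n x w ≤ 8 * (n * (1 + |x|)) :=
  ⟨(G_two n x).trans (G_mono n hn x 2 w le_rfl hw.1),
    (G_mono n hn x w 8 hw.1 hw.2).trans (G_eight n hn x)⟩

/-- Integrand. -/
noncomputable def g (n : ℕ) (w : ℝ → ℝ) (y : ℝ) : ℝ :=
  (|y| ^ (n - 1) * Real.exp (n * y)) * G n y (w y)

/-- Dominating function, the derivative of E on the positive axis. -/
noncomputable def D (n : ℕ) (y : ℝ) : ℝ :=
  (|y| ^ (n - 1) * Real.exp (n * y)) * (n * (1 + |y|))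

noncomputable def E (n : ℕ) (x : ℝ) : ℝ := x ^ n * Real.exp (n * x)

lemma E_pos (n : ℕ) (x : ℝ) (hx : 0 < x) : 0 < E n x := by unfold E; positivity

lemma D_cont (n : ℕ) : Continuous (D n) := by unfold D; fun_prop

lemma E_deriv (n : ℕ) (hn : 2 ≤ n) (x : ℝ) (hx : 0 ≤ x) : HasDerivAt (E n) (D n x) x := by
  have h1 : HasDerivAt (fun x : ℝ => Real.exp (n * x)) (Real.exp (n * x) * n) x := by
    have := ((hasDerivAt_id x).const_mul (n : ℝ)).exp
    simpa using this
  have := (hasDerivAt_pow n x).mul h1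
  unfold E D
  refine this.congr_deriv ?_
  rw [abs_of_nonneg hx]
  obtain ⟨m, rfl⟩ : ∃ m, n = m + 1 := ⟨n - 1, by omega⟩
  simp only [Nat.add_sub_cancel, pow_succ]
  ring

lemma D_int (n : ℕ) (hn : 2 ≤ n) (x : ℝ) (hx : 0 ≤ x) : ∫ y in (0 : ℝ)..x, D n y = E n x := by
  rw [intervalIntegral.integral_eq_sub_of_hasDerivAt (f := E n)]
  · have : E n 0 = 0 := by unfold E; rw [zero_pow (by omega)]; simp
    rw [this, sub_zero]
  · intro y hy
    rw [uIcc_of_le hx] at hy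
    exact E_deriv n hn y hy.1
  · exact (D_cont n).intervalIntegrable _ _

lemma g_bounds (n : ℕ) (hn : 2 ≤ n) (w : ℝ → ℝ) (hw : ∀ y, w y ∈ Icc (2 : ℝ) 8) (y : ℝ) :
    2 * D n y ≤ g n w y ∧ g n w y ≤ 8 * D n y := by
  have h := G_bounds n hn y (w y) (hw y)
  have hp : 0 ≤ |y| ^ (n - 1) * Real.exp (n * y) := by positivity
  unfold g D
  constructor
  · have := mul_le_mul_of_nonneg_left h.1 hp
    linarith
  · have := mul_le_mul_of_nonneg_left h.2 hp
    linarith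

lemma D_nonneg (n : ℕ) (y : ℝ) : 0 ≤ D n y := by unfold D; positivity

lemma g_norm (n : ℕ) (hn : 2 ≤ n) (w : ℝ → ℝ) (hw : ∀ y, w y ∈ Icc (2 : ℝ) 8) (y : ℝ) :
    ‖g n w y‖ ≤ 8 * D n y := by
  have h := g_bounds n hn w hw y
  have := D_nonneg n y
  rw [Real.norm_of_nonneg (by linarith)]
  exact h.2

lemma g_meas (n : ℕ) (w : ℝ → ℝ) (hm : Measurable w) : Measurable (g n w) := by
  unfold g G
  fun_prop

lemma g_ii (n : ℕ) (hn : 2 ≤ n) (w : ℝ → ℝ) (hm : Measurable w)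
    (hw : ∀ y, w y ∈ Icc (2 : ℝ) 8) (a b : ℝ) :
    IntervalIntegrable (g n w) MeasureTheory.volume a b := by
  have hD : IntervalIntegrable (fun y => 8 * D n y) MeasureTheory.volume a b :=
    ((D_cont n).const_mul 8).intervalIntegrable _ _
  refine hD.mono_fun (g_meas n w hm).aestronglyMeasurable ?_
  refine Eventually.of_forall fun y => ?_
  refine (g_norm n hn w hw y).trans (le_abs_self _)

/-- The monotone integral operator. -/
noncomputable def T (n : ℕ) (w : ℝ → ℝ) (x : ℝ) : ℝ :=
  if 0 < x then (∫ y in (0 : ℝ)..x, g n w y) / E n x else 2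

lemma T_meas (n : ℕ) (hn : 2 ≤ n) (w : ℝ → ℝ) (hm : Measurable w)
    (hw : ∀ y, w y ∈ Icc (2 : ℝ) 8) : Measurable (T n w) := by
  have h1 : Continuous fun x => ∫ y in (0 : ℝ)..x, g n w y :=
    intervalIntegral.continuous_primitive (g_ii n hn w hm hw) 0
  have h2 : Continuous (E n) := by unfold E; fun_prop
  exact Measurable.ite measurableSet_Ioi (h1.measurable.div h2.measurable) measurable_const

lemma T_bounds (n : ℕ) (hn : 2 ≤ n) (w : ℝ → ℝ) (hm : Measurable w)
    (hw : ∀ y, w y ∈ Icc (2 : ℝ) 8) (x : ℝ) : T n w x ∈ Icc (2 : ℝ) 8 := by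
  unfold T
  split_ifs with hx
  · have hE := E_pos n x hx
    have hDi : ∀ c : ℝ, IntervalIntegrable (fun y => c * D n y) MeasureTheory.volume 0 x :=
      fun c => ((D_cont n).const_mul c).intervalIntegrable _ _
    have h1 : ∫ y in (0 : ℝ)..x, 2 * D n y ≤ ∫ y in (0 : ℝ)..x, g n w y :=
      intervalIntegral.integral_mono hx.le (hDi 2) (g_ii n hn w hm hw 0 x)
        (fun y => (g_bounds n hn w hw y).1)
    have h2 : ∫ y in (0 : ℝ)..x, g n w y ≤ ∫ y in (0 : ℝ)..x, 8 * D n y :=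
      intervalIntegral.integral_mono hx.le (g_ii n hn w hm hw 0 x) (hDi 8)
        (fun y => (g_bounds n hn w hw y).2)
    rw [intervalIntegral.integral_const_mul, D_int n hn x hx.le] at h1 h2
    exact ⟨(le_div_iff₀ hE).2 h1, (div_le_iff₀ hE).2 h2⟩
  · norm_num

lemma T_mono (n : ℕ) (hn : 2 ≤ n) (v w : ℝ → ℝ) (hvm : Measurable v) (hwm : Measurable w)
    (hv : ∀ y, v y ∈ Icc (2 : ℝ) 8) (hw : ∀ y, w y ∈ Icc (2 : ℝ) 8) (h : ∀ y, v y ≤ w y) (x : ℝ) :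
    T n v x ≤ T n w x := by
  unfold T
  split_ifs with hx
  · have hE := E_pos n x hx
    refine div_le_div_of_nonneg_right ?_ hE.le
    refine intervalIntegral.integral_mono hx.le (g_ii n hn v hvm hv 0 x) (g_ii n hn w hwm hw 0 x) ?_
    intro y
    exact mul_le_mul_of_nonneg_left (G_mono n hn y _ _ (hv y).1 (h y)) (by positivity)
  · exact le_rfl

/-- Iterates. -/
noncomputable def it (n : ℕ) : ℕ → ℝ → ℝ
  | 0 => fun _ => 2
  | k + 1 => T n (it n k)

lemma it_prop (n : ℕ) (hn : 2 ≤ n) (k : ℕ) :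
    Measurable (it n k) ∧ ∀ y, it n k y ∈ Icc (2 : ℝ) 8 := by
  induction k with
  | zero => exact ⟨measurable_const, fun y => by simp only [it]; norm_num⟩
  | succ k ih => exact ⟨T_meas n hn _ ih.1 ih.2, T_bounds n hn _ ih.1 ih.2⟩

lemma it_mono_succ (n : ℕ) (hn : 2 ≤ n) (k : ℕ) : ∀ y, it n k y ≤ it n (k + 1) y := by
  induction k with
  | zero => exact fun y => ((it_prop n hn 1).2 y).1
  | succ k ih =>
    exact fun y => T_mono n hn _ _ (it_prop n hn k).1 (it_prop n hn (k + 1)).1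
      (it_prop n hn k).2 (it_prop n hn (k + 1)).2 ih y

lemma exists_fixed (n : ℕ) (hn : 2 ≤ n) : ∃ w : ℝ → ℝ, Measurable w ∧
    (∀ y, w y ∈ Icc (2 : ℝ) 8) ∧ ∀ x, 0 < x → w x = (∫ y in (0 : ℝ)..x, g n w y) / E n x := by
  have hmono : ∀ y, Monotone fun k => it n k y :=
    fun y => monotone_nat_of_le_succ fun k => it_mono_succ n hn k y
  have hb : ∀ y, BddAbove (range fun k => it n k y) := by
    intro y
    refine ⟨8, ?_⟩
    rintro _ ⟨k, rfl⟩
    exact ((it_prop n hn k).2 y).2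
  have hlim : ∀ y, Tendsto (fun k => it n k y) atTop (𝓝 (⨆ k, it n k y)) :=
    fun y => tendsto_atTop_ciSup (hmono y) (hb y)
  have hW : ∀ y, (⨆ k, it n k y) ∈ Icc (2 : ℝ) 8 := fun y =>
    isClosed_Icc.mem_of_tendsto (hlim y) (Eventually.of_forall fun k => (it_prop n hn k).2 y)
  refine ⟨fun y => ⨆ k, it n k y, ?_, hW, ?_⟩
  · exact measurable_of_tendsto_metrizable (fun k => (it_prop n hn k).1)
      (tendsto_pi_nhds.2 hlim)
  · intro x hx
    have h1 : Tendsto (fun k => it n (k + 1) x) atTop (𝓝 (⨆ k, it n k x)) :=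
      (hlim x).comp (tendsto_add_atTop_nat 1)
    have h2 : Tendsto (fun k => ∫ y in (0 : ℝ)..x, g n (it n k) y) atTop
        (𝓝 (∫ y in (0 : ℝ)..x, g n (fun y => ⨆ k, it n k y) y)) := by
      refine intervalIntegral.tendsto_integral_filter_of_dominated_convergence
        (fun y => 8 * D n y) ?_ ?_ ?_ ?_
      · exact Eventually.of_forall fun k => (g_meas n _ (it_prop n hn k).1).aestronglyMeasurable
      · exact Eventually.of_forall fun k => Eventually.of_forall fun y _ =>
          g_norm n hn _ (it_prop n hn k).2 y
      · exact ((D_cont n).const_mul 8).intervalIntegrable _ _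
      · refine Eventually.of_forall fun y _ => ?_
        have hne : (⨆ k, it n k y) ≠ 0 := by have := (hW y).1; linarith
        have hl := hlim y
        unfold g G
        refine Tendsto.const_mul _ ?_
        refine Tendsto.add (Tendsto.sub (Tendsto.add_const _ ((hl.mul_const _).div_const _)) ?_)
          (hl.const_mul _)
        exact Tendsto.mul_const _ (Tendsto.const_mul _
          (tendsto_const_nhds.sub (tendsto_const_nhds.div hl hne)))
    have h3 := h2.div_const (E n x)
    refine tendsto_nhds_unique h1 (h3.congr fun k => ?_)
    simp only [it, T, if_pos hx]

lemma exists_w (n : ℕ) (hn : 2 ≤ n) : ∃ w : ℝ → ℝ, (∀ y, w y ∈ Icc (2 : ℝ) 8) ∧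
    ∀ x, 0 < x → HasDerivAt w ((G n x (w x) - n * (1 + |x|) * w x) / x) x := by
  obtain ⟨w, hm, hw, hfix⟩ := exists_fixed n hn
  refine ⟨w, hw, fun x hx => ?_⟩
  have hii := g_ii n hn w hm hw
  have hIc : Continuous fun x => ∫ y in (0 : ℝ)..x, g n w y :=
    intervalIntegral.continuous_primitive hii 0
  have hE := E_pos n x hx
  have hEd := E_deriv n hn x hx.le
  have hev : w =ᶠ[𝓝 x] fun x => (∫ y in (0 : ℝ)..x, g n w y) / E n x := by
    filter_upwards [lt_mem_nhds hx] with y hy using hfix y hy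
  have hwc : ContinuousAt w x :=
    (hIc.continuousAt.div hEd.continuousAt hE.ne').congr hev.symm
  have hne : w x ≠ 0 := by have := (hw x).1; linarith
  have hgc : ContinuousAt (g n w) x := by
    have ha : 1 + |x| ≠ 0 := by positivity
    unfold g G
    fun_prop (disch := assumption)
  have hId := intervalIntegral.integral_hasDerivAt_right (hii 0 x)
    ((g_meas n w hm).stronglyMeasurable.stronglyMeasurableAtFilter) hgc
  refine ((hId.div hEd hE.ne').congr_of_eventuallyEq hev).congr_deriv ?_
  have hI : (∫ y in (0 : ℝ)..x, g n w y) = w x * E n x := by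
    rw [hfix x hx, div_mul_cancel₀ _ hE.ne']
  rw [hI]
  have hEx : E n x = x * (|x| ^ (n - 1) * Real.exp (n * x)) := by
    unfold E
    rw [abs_of_pos hx, ← mul_assoc, ← pow_succ', Nat.sub_add_cancel (by omega)]
  have hq : 0 < |x| ^ (n - 1) * Real.exp (n * x) := by positivity
  unfold g D
  rw [hEx]
  set q := |x| ^ (n - 1) * Real.exp (n * x)
  field_simp

/-- Right-hand side in the logarithmic variable. -/
noncomputable def H (n : ℕ) (t w : ℝ) : ℝ :=
  w * (1 - 3 / (1 + Real.exp t)) / 2 + 2 - ((n : ℝ) - 1) * (1 - 2 / w) * (1 + Real.exp t)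

lemma exists_W (n : ℕ) (hn : 2 ≤ n) : ∃ W : ℝ → ℝ, (∀ t, W t ∈ Icc (2 : ℝ) 8) ∧
    (∀ t, HasDerivAt W (H n t (W t)) t) ∧ ContDiff ℝ (⊤ : ℕ∞) W := by
  obtain ⟨w, hw, hd⟩ := exists_w n hn
  have hWd : ∀ t, HasDerivAt (fun t => w (Real.exp t)) (H n t (w (Real.exp t))) t := by
    intro t
    refine ((hd _ (Real.exp_pos t)).comp t (Real.hasDerivAt_exp t)).congr_deriv ?_
    unfold G H
    rw [abs_of_pos (Real.exp_pos t), div_mul_cancel₀ _ (Real.exp_pos t).ne']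
    ring
  refine ⟨fun t => w (Real.exp t), fun t => hw _, hWd, ?_⟩
  set W := fun t => w (Real.exp t) with hWdef
  have hne : ∀ t, W t ≠ 0 := fun t => by have := (hw (Real.exp t)).1; simp only [hWdef]; linarith
  have hne2 : ∀ t, 1 + Real.exp t ≠ 0 := fun t => by positivity
  rw [contDiff_infty]
  intro k
  induction k with
  | zero =>
    have : Continuous W := continuous_iff_continuousAt.2 fun t => (hWd t).continuousAt
    exact contDiff_zero.2 this
  | succ k ih =>
    have hder : deriv W = fun t => H n t (W t) := funext fun t => (hWd t).deriv
    have : ((k + 1 : ℕ) : WithTop ℕ∞) = (k : WithTop ℕ∞) + 1 := by norm_cast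
    rw [this, contDiff_succ_iff_deriv]
    refine ⟨fun t => (hWd t).differentiableAt, by simp, ?_⟩
    rw [hder]
    unfold H
    fun_prop (disch := assumption)

lemma exists_S (W : ℝ → ℝ) (hW : ∀ t, W t ∈ Icc (2 : ℝ) 8) (hc : ContDiff ℝ (⊤ : ℕ∞) W) :
    ∃ S : ℝ ≃o ℝ, (∀ s, HasDerivAt S (W (S s)) s) ∧ ContDiff ℝ (⊤ : ℕ∞) S := by
  have hpos : ∀ t, 0 < W t := fun t => by have := (hW t).1; linarith
  have hne : ∀ t, W t ≠ 0 := fun t => (hpos t).ne'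
  have hci : ContDiff ℝ (⊤ : ℕ∞) fun t => (W t)⁻¹ := hc.inv hne
  have hcc : Continuous fun t => (W t)⁻¹ := hci.continuous
  set L : ℝ → ℝ := fun x => ∫ y in (0 : ℝ)..x, (W y)⁻¹ with hL
  have hLd : ∀ t, HasDerivAt L (W t)⁻¹ t := fun t =>
    intervalIntegral.integral_hasDerivAt_right (hcc.intervalIntegrable _ _)
      hcc.stronglyMeasurable.stronglyMeasurableAtFilter hcc.continuousAt
  have hLdiff : Differentiable ℝ L := fun t => (hLd t).differentiableAt
  have hder : deriv L = fun t => (W t)⁻¹ := funext fun t => (hLd t).deriv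
  have hLc : ContDiff ℝ (⊤ : ℕ∞) L := by
    rw [contDiff_infty_iff_deriv, hder]
    exact ⟨hLdiff, hci⟩
  have hsm : StrictMono L := strictMono_of_deriv_pos fun t => by
    rw [(hLd t).deriv]; exact inv_pos.2 (hpos t)
  have h0 : L 0 = 0 := by simp [hL]
  have hm : Monotone fun t => L t - t / 8 := by
    have hd : ∀ t, HasDerivAt (fun t => L t - t / 8) ((W t)⁻¹ - 1 / 8) t := fun t =>
      (hLd t).sub ((hasDerivAt_id t).div_const 8)
    refine monotone_of_deriv_nonneg (fun t => (hd t).differentiableAt) fun t => ?_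
    rw [(hd t).deriv, sub_nonneg, one_div]
    exact inv_anti₀ (hpos t) (hW t).2
  have htop : Tendsto L atTop atTop := by
    refine tendsto_atTop_mono' _ ?_ (tendsto_id.atTop_div_const (by norm_num : (0 : ℝ) < 8))
    filter_upwards [eventually_ge_atTop 0] with t ht
    have := hm ht
    simp only [h0, id] at this ⊢
    linarith
  have hbot : Tendsto L atBot atBot := by
    refine tendsto_atBot_mono' _ ?_ (tendsto_id.atBot_div_const (by norm_num : (0 : ℝ) < 8))
    filter_upwards [eventually_le_atBot 0] with t ht
    have := hm ht
    simp only [h0, id] at this ⊢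
    linarith
  have hsurj : Function.Surjective L := hLdiff.continuous.surjective htop hbot
  let e : ℝ ≃o ℝ := hsm.orderIsoOfSurjective L hsurj
  have he : ∀ t, e t = L t := fun t => rfl
  refine ⟨e.symm, fun s => ?_, ?_⟩
  · have h1 : HasDerivAt L (W (e.symm s))⁻¹ (e.symm s) := hLd _
    have h2 := HasDerivAt.of_local_left_inverse (f := L) (g := e.symm) (a := s)
      e.symm.continuous.continuousAt h1 (inv_ne_zero (hne _))
      (Eventually.of_forall fun y => e.apply_symm_apply y)
    simpa using h2
  · exact Homeomorph.contDiff_symm_deriv (f := e.toHomeomorph) (f' := fun t => (W t)⁻¹)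
      (fun t => inv_ne_zero (hne t)) hLd hLc

end BryantAux

/-- Existence of the Bryant soliton profile function: a smooth `B : (0,∞) → (0,1)`
with `F[B] = 0`, `B(0⁺) = 1`, `B(∞) = 0`, strictly monotone decreasing. -/
theorem bryant_soliton_profile_exists (n : ℕ) (hn : 2 ≤ n) :
    ∃ B : ℝ → ℝ,
      ContDiffOn ℝ (⊤ : ℕ∞) B (Set.Ioi (0 : ℝ)) ∧
      (∀ r > (0 : ℝ), B r ∈ Set.Ioo (0 : ℝ) 1) ∧
      (∀ r > (0 : ℝ), bryantOp n B r = 0) ∧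
      Filter.Tendsto B (nhdsWithin 0 (Set.Ioi 0)) (nhds 1) ∧
      Filter.Tendsto B Filter.atTop (nhds 0) ∧
      StrictAntiOn B (Set.Ioi 0) := by
  obtain ⟨W, hW, hWd, hWc⟩ := BryantAux.exists_W n hn
  obtain ⟨S, hSd, hSc⟩ := BryantAux.exists_S W hW hWc
  have hWpos : ∀ t, 0 < W t := fun t => by have := (hW t).1; linarith
  have hX : ∀ r > (0 : ℝ), HasDerivAt (fun r => S (Real.log r)) (W (S (Real.log r)) * r⁻¹) r :=
    fun r hr => (hSd _).comp r (Real.hasDerivAt_log hr.ne')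
  have hB1 : ∀ r > (0 : ℝ), HasDerivAt (fun r => (1 + Real.exp (S (Real.log r)))⁻¹)
      (-(Real.exp (S (Real.log r)) * (W (S (Real.log r)) * r⁻¹)) /
        (1 + Real.exp (S (Real.log r))) ^ 2) r := by
    intro r hr
    exact ((hX r hr).exp.const_add 1).inv (by positivity)
  refine ⟨fun r => (1 + Real.exp (S (Real.log r)))⁻¹, ?_, ?_, ?_, ?_, ?_, ?_⟩
  · have hlog : ContDiffOn ℝ (⊤ : ℕ∞) Real.log (Set.Ioi 0) :=
      Real.contDiffOn_log.mono fun x hx => (ne_of_gt hx : x ≠ 0)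
    refine ContDiffOn.inv ?_ fun r _ => by positivity
    exact contDiffOn_const.add ((Real.contDiff_exp.comp hSc).comp_contDiffOn hlog)
  · intro r _
    have := Real.exp_pos (S (Real.log r))
    exact ⟨by positivity, inv_lt_one_of_one_lt₀ (by linarith)⟩
  · intro r hr
    have hev : deriv (fun r => (1 + Real.exp (S (Real.log r)))⁻¹) =ᶠ[nhds r] fun r =>
        (-(Real.exp (S (Real.log r)) * (W (S (Real.log r)) * r⁻¹)) /
        (1 + Real.exp (S (Real.log r))) ^ 2) := by
      filter_upwards [lt_mem_nhds hr] with y hy using (hB1 y hy).deriv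
    have hWS := (hWd (S (Real.log r))).comp r (hX r hr)
    have h2 := ((((hX r hr).exp.mul (hWS.mul (hasDerivAt_inv hr.ne'))).neg).div
      (((hX r hr).exp.const_add 1).pow 2)
      (pow_ne_zero 2 (by positivity : (1 + Real.exp (S (Real.log r))) ≠ 0)))
    have hd2 := hev.deriv_eq.trans h2.deriv
    unfold bryantOp
    rw [hd2, (hB1 r hr).deriv]
    unfold BryantAux.H
    simp only [Function.comp, Pi.mul_apply, Pi.pow_apply, Pi.neg_apply]
    have hw := hWpos (S (Real.log r))
    have hx := Real.exp_pos (S (Real.log r))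
    set x := Real.exp (S (Real.log r))
    set w := W (S (Real.log r))
    have h1x : 1 + x ≠ 0 := by positivity
    have hw' := hw.ne'
    have hr' := hr.ne'
    field_simp
    push_cast
    ring
  · have h1 : Filter.Tendsto (fun r => Real.exp (S (Real.log r))) (nhdsWithin 0 (Set.Ioi 0))
        (nhds 0) :=
      Real.tendsto_exp_atBot.comp (S.tendsto_atBot.comp Real.tendsto_log_nhdsGT_zero)
    have := (h1.const_add 1).inv₀ (by norm_num)
    simpa using this
  · have h1 : Filter.Tendsto (fun r => Real.exp (S (Real.log r))) Filter.atTop Filter.atTop :=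
      Real.tendsto_exp_atTop.comp (S.tendsto_atTop.comp Real.tendsto_log_atTop)
    exact (Filter.tendsto_atTop_add_const_left _ 1 h1).inv_tendsto_atTop
  · intro a ha b hb hab
    have h1 : S (Real.log a) < S (Real.log b) := S.strictMono (Real.log_lt_log ha hab)
    have h2 := Real.exp_lt_exp.2 h1
    have := Real.exp_pos (S (Real.log a))
    exact inv_strictAnti₀ (by positivity) (by linarith)
end

section
/- Fix an integer n ≥ 2. If Z₁ and Z₂ are two twice continuously differentiable functions from (0, ∞) to (0, 1) satisfying F[Z_i](r) = 0 for all r > 0, lim_{r→0⁺} Z_i(r) = 1, and lim_{r→∞} Z_i(r) = 0 (i = 1, 2), then there exists a scaling parameter ρ > 0 such that Z₂(r) = Z₁(r/ρ) for all r > 0. In other words, the complete solutions of the Bryant soliton equation with boundary values Z(0) = 1 and Z(∞) = 0 form exactly a one-parameter family related by rescaling. -/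
/-- A solution in the logarithmic variable `s = log r`, with `m = n - 1`. -/
structure LogSol (m : ℝ) (u p q : ℝ → ℝ) : Prop where
  hu : ∀ s, HasDerivAt u (p s) s
  hp : ∀ s, HasDerivAt p (q s) s
  eqn : ∀ s, u s * q s - (p s) ^ 2 / 2 + (m - 2 * u s) * p s + 2 * m * (1 - u s) * u s = 0
  pos : ∀ s, 0 < u s
  lt_one : ∀ s, u s < 1
  bot : Filter.Tendsto u Filter.atBot (nhds 1)
  top : Filter.Tendsto u Filter.atTop (nhds 0)

theorem LogSol.q_neg {m : ℝ} (hm : 0 < m) {u p q : ℝ → ℝ} (h : LogSol m u p q) {s : ℝ}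
    (hs : p s = 0) : q s < 0 := by
  have e := h.eqn s
  have h0 := h.pos s
  have h1 := h.lt_one s
  rw [hs] at e
  have h2 : 0 < 2 * m * (1 - u s) := by
    have : 0 < 1 - u s := by linarith
    positivity
  have h3 : u s * (q s + 2 * m * (1 - u s)) = 0 := by linarith
  rcases mul_eq_zero.1 h3 with h4 | h4
  · linarith
  · linarith

theorem LogSol.p_nonpos {m : ℝ} (hm : 0 < m) {u p q : ℝ → ℝ} (h : LogSol m u p q) (s₀ : ℝ) :
    p s₀ ≤ 0 := by
  by_contra hs
  have hpos : ∀ a ≤ s₀, 0 < p a := by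
    intro a ha
    by_contra hpa
    have := image_le_of_deriv_right_lt_deriv_boundary (f := p) (f' := q) (a := a) (b := s₀)
      (B := fun _ => (0 : ℝ)) (B' := fun _ => (0 : ℝ))
      (fun x _ => (h.hp x).continuousAt.continuousWithinAt)
      (fun x _ => (h.hp x).hasDerivWithinAt) (by simpa using hpa)
      (fun x => hasDerivAt_const x 0)
      (fun x _ hx => h.q_neg hm hx) (x := s₀) ⟨ha, le_rfl⟩
    exact hs this
  have hmono : MonotoneOn u (Set.Iic s₀) := by
    apply monotoneOn_of_deriv_nonneg (convex_Iic s₀)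
    · exact fun x _ => (h.hu x).continuousAt.continuousWithinAt
    · exact fun x _ => (h.hu x).differentiableAt.differentiableWithinAt
    · intro x hx
      rw [(h.hu x).deriv]
      exact (hpos x (Set.mem_Iic.1 (interior_subset hx))).le
  have : (1 : ℝ) ≤ u s₀ := by
    apply le_of_tendsto h.bot
    filter_upwards [Filter.eventually_le_atBot s₀] with x hx
    exact hmono hx (Set.mem_Iic.2 le_rfl) hx
  linarith [h.lt_one s₀]

theorem LogSol.p_neg {m : ℝ} (hm : 0 < m) {u p q : ℝ → ℝ} (h : LogSol m u p q) (s : ℝ) :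
    p s < 0 := by
  refine lt_of_le_of_ne (h.p_nonpos hm s) ?_
  intro hs
  have hmax : IsLocalMax p s := Filter.Eventually.of_forall fun x => by
    show p x ≤ p s
    rw [hs]; exact h.p_nonpos hm x
  have := hmax.hasDerivAt_eq_zero (h.hp s)
  have := h.q_neg hm hs
  linarith

theorem LogSol.anti {m : ℝ} (hm : 0 < m) {u p q : ℝ → ℝ} (h : LogSol m u p q) :
    StrictAnti u :=
  strictAnti_of_deriv_neg fun x => by rw [(h.hu x).deriv]; exact h.p_neg hm x

/-- The inverse function of a solution. -/
theorem LogSol.inv {m : ℝ} (hm : 0 < m) {u p q : ℝ → ℝ} (h : LogSol m u p q) :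
    ∃ v : ℝ → ℝ, (∀ y ∈ Set.Ioo (0 : ℝ) 1, u (v y) = y) ∧ (∀ s, v (u s) = s) ∧
      ∀ y ∈ Set.Ioo (0 : ℝ) 1, HasDerivAt v (p (v y))⁻¹ y := by
  have hcont : Continuous u := continuous_iff_continuousAt.2 fun x => (h.hu x).continuousAt
  have hex : ∀ y, ∃ t, y ∈ Set.Ioo (0 : ℝ) 1 → u t = y := by
    intro y
    by_cases hy : y ∈ Set.Ioo (0 : ℝ) 1
    · obtain ⟨a, ha⟩ := (h.top.eventually (gt_mem_nhds hy.1)).exists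
      obtain ⟨b, hb⟩ := (h.bot.eventually (lt_mem_nhds hy.2)).exists
      obtain ⟨t, ht⟩ := mem_range_of_exists_le_of_exists_ge hcont ⟨a, le_of_lt ha⟩ ⟨b, le_of_lt hb⟩
      exact ⟨t, fun _ => ht⟩
    · exact ⟨0, fun hy' => absurd hy' hy⟩
  choose v hv using hex
  have hmem : ∀ s, u s ∈ Set.Ioo (0 : ℝ) 1 := fun s => ⟨h.pos s, h.lt_one s⟩
  have hvu : ∀ s, v (u s) = s := fun s => (h.anti hm).injective (hv _ (hmem s))
  refine ⟨v, hv, hvu, ?_⟩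
  intro y hy
  have hnhds : Set.Ioo (0 : ℝ) 1 ∈ nhds y := Ioo_mem_nhds hy.1 hy.2
  have hmono : StrictMonoOn (fun y => -v y) (Set.Ioo (0 : ℝ) 1) := by
    intro a ha b hb hab
    have : v b < v a := by
      rw [← (h.anti hm).lt_iff_gt, hv a ha, hv b hb]
      exact hab
    simpa using this
  have hc : ContinuousAt (fun y => -v y) y := by
    apply hmono.continuousAt_of_image_mem_nhds hnhds
    have : (fun y => -v y) '' Set.Ioo (0 : ℝ) 1 = Set.univ := by
      apply Set.eq_univ_of_forall
      intro t
      exact ⟨u (-t), hmem _, by simp [hvu]⟩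
    rw [this]
    exact Filter.univ_mem
  have hc' : ContinuousAt v y := by
    have h5 := hc.neg
    have h6 : -(fun y => -v y) = v := by
      funext z; simp
    rwa [h6] at h5
  apply HasDerivAt.of_local_left_inverse hc' (h.hu (v y)) (h.p_neg hm _).ne
  filter_upwards [hnhds] with z hz using hv z hz

theorem LogSol.not_le {m : ℝ} {u p q : ℝ → ℝ} (h : LogSol m u p q) {d s₀ : ℝ} (hd : d < 0)
    (hp : ∀ s ≤ s₀, p s ≤ d) : False := by
  have hanti : AntitoneOn (fun s => u s - d * s) (Set.Iic s₀) := by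
    have hder : ∀ x, HasDerivAt (fun s => u s - d * s) (p x - d) x := fun x => by
      have h5 := (h.hu x).sub ((hasDerivAt_id x).const_mul d)
      rw [mul_one] at h5
      exact h5
    apply antitoneOn_of_deriv_nonpos (convex_Iic s₀)
    · exact fun x _ => (hder x).continuousAt.continuousWithinAt
    · exact fun x _ => (hder x).differentiableAt.differentiableWithinAt
    · intro x hx
      rw [(hder x).deriv]
      linarith [hp x (Set.mem_Iic.1 (interior_subset hx))]
  have hle : s₀ + 1 / d ≤ s₀ := by
    have : 1 / d < 0 := one_div_neg.2 hd
    linarith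
  have h1 := hanti (Set.mem_Iic.2 hle) (Set.mem_Iic.2 le_rfl) hle
  have h2 : d * (s₀ + 1 / d) = d * s₀ + 1 := by
    rw [mul_add, mul_one_div_cancel hd.ne]
  simp only [h2] at h1
  linarith [h.lt_one (s₀ + 1 / d), h.pos s₀]

theorem LogSol.slope_le {m : ℝ} (hm : 0 < m) {u₁ p₁ q₁ u₂ p₂ q₂ : ℝ → ℝ}
    (h₁ : LogSol m u₁ p₁ q₁) (h₂ : LogSol m u₂ p₂ q₂) {v₁ v₂ : ℝ → ℝ}
    (a₁ : ∀ y ∈ Set.Ioo (0 : ℝ) 1, u₁ (v₁ y) = y) (b₁ : ∀ s, v₁ (u₁ s) = s)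
    (c₁ : ∀ y ∈ Set.Ioo (0 : ℝ) 1, HasDerivAt v₁ (p₁ (v₁ y))⁻¹ y)
    (a₂ : ∀ y ∈ Set.Ioo (0 : ℝ) 1, u₂ (v₂ y) = y)
    (c₂ : ∀ y ∈ Set.Ioo (0 : ℝ) 1, HasDerivAt v₂ (p₂ (v₂ y))⁻¹ y)
    {y₀ : ℝ} (hy₀ : y₀ ∈ Set.Ioo (0 : ℝ) 1) : p₂ (v₂ y₀) ≤ p₁ (v₁ y₀) := by
  by_contra hlt
  push Not at hlt
  have hd : p₁ (v₁ y₀) - p₂ (v₂ y₀) < 0 := by linarith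
  set d := p₁ (v₁ y₀) - p₂ (v₂ y₀) with hdd
  have hder : ∀ y ∈ Set.Ioo (0 : ℝ) 1, HasDerivAt (fun y => p₁ (v₁ y) - p₂ (v₂ y))
      (q₁ (v₁ y) * (p₁ (v₁ y))⁻¹ - q₂ (v₂ y) * (p₂ (v₂ y))⁻¹) y := fun y hy =>
    ((h₁.hp (v₁ y)).comp y (c₁ y hy)).sub ((h₂.hp (v₂ y)).comp y (c₂ y hy))
  have hkey : ∀ y ∈ Set.Ioo (0 : ℝ) 1, p₁ (v₁ y) - p₂ (v₂ y) = d →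
      q₁ (v₁ y) * (p₁ (v₁ y))⁻¹ - q₂ (v₂ y) * (p₂ (v₂ y))⁻¹ < 0 := by
    intro y hy hyd
    have e₁ := h₁.eqn (v₁ y)
    have e₂ := h₂.eqn (v₂ y)
    rw [a₁ y hy] at e₁
    rw [a₂ y hy] at e₂
    have n₁ := h₁.p_neg hm (v₁ y)
    have n₂ := h₂.p_neg hm (v₂ y)
    generalize p₁ (v₁ y) = P₁ at *
    generalize p₂ (v₂ y) = P₂ at *
    generalize q₁ (v₁ y) = Q₁ at *
    generalize q₂ (v₂ y) = Q₂ at *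
    have hy0 : 0 < y := hy.1
    have hy1 : 0 < 1 - y := by linarith [hy.2]
    have f₁ : Q₁ = (P₁ ^ 2 / 2 - (m - 2 * y) * P₁ - 2 * m * (1 - y) * y) / y := by
      rw [eq_div_iff hy0.ne']; linarith
    have f₂ : Q₂ = (P₂ ^ 2 / 2 - (m - 2 * y) * P₂ - 2 * m * (1 - y) * y) / y := by
      rw [eq_div_iff hy0.ne']; linarith
    have hP : 0 < P₁ * P₂ := mul_pos_of_neg_of_neg n₁ n₂
    have : Q₁ * P₁⁻¹ - Q₂ * P₂⁻¹ =
        (P₁ - P₂) * (1 / (2 * y) + 2 * m * (1 - y) / (P₁ * P₂)) := by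
      rw [f₁, f₂]
      have := n₁.ne
      have := n₂.ne
      field_simp
      ring
    rw [this, hyd]
    apply mul_neg_of_neg_of_pos hd
    positivity
  have hle : ∀ y, y₀ ≤ y → y < 1 → p₁ (v₁ y) - p₂ (v₂ y) ≤ d := by
    intro b hb hb1
    have hsub : ∀ x, x ∈ Set.Icc y₀ b → x ∈ Set.Ioo (0 : ℝ) 1 := fun x hx =>
      ⟨lt_of_lt_of_le hy₀.1 hx.1, lt_of_le_of_lt hx.2 hb1⟩
    exact image_le_of_deriv_right_lt_deriv_boundary (a := y₀) (b := b)
      (f := fun y => p₁ (v₁ y) - p₂ (v₂ y))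
      (f' := fun y => q₁ (v₁ y) * (p₁ (v₁ y))⁻¹ - q₂ (v₂ y) * (p₂ (v₂ y))⁻¹)
      (B := fun _ => d) (B' := fun _ => (0 : ℝ))
      (fun x hx => (hder x (hsub x hx)).continuousAt.continuousWithinAt)
      (fun x hx => (hder x (hsub x (Set.Ico_subset_Icc_self hx))).hasDerivWithinAt)
      le_rfl (fun x => hasDerivAt_const x d)
      (fun x hx hxd => hkey x (hsub x (Set.Ico_subset_Icc_self hx)) hxd) (x := b) ⟨hb, le_rfl⟩
  apply h₁.not_le hd (s₀ := v₁ y₀)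
  intro s hs
  have h3 : y₀ ≤ u₁ s := by
    have := (h₁.anti hm).antitone hs
    rwa [a₁ y₀ hy₀] at this
  have h4 := hle (u₁ s) h3 (h₁.lt_one s)
  rw [b₁] at h4
  linarith [h₂.p_neg hm (v₂ (u₁ s))]

theorem LogSol.unique {m : ℝ} (hm : 0 < m) {u₁ p₁ q₁ u₂ p₂ q₂ : ℝ → ℝ}
    (h₁ : LogSol m u₁ p₁ q₁) (h₂ : LogSol m u₂ p₂ q₂) :
    ∃ c, ∀ s, u₂ s = u₁ (s + c) := by
  obtain ⟨v₁, a₁, b₁, c₁⟩ := h₁.inv hm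
  obtain ⟨v₂, a₂, b₂, c₂⟩ := h₂.inv hm
  have heq : ∀ y ∈ Set.Ioo (0 : ℝ) 1, p₁ (v₁ y) = p₂ (v₂ y) := fun y hy =>
    le_antisymm (LogSol.slope_le hm h₂ h₁ a₂ b₂ c₂ a₁ c₁ hy)
      (LogSol.slope_le hm h₁ h₂ a₁ b₁ c₁ a₂ c₂ hy)
  have hder : ∀ y ∈ Set.Ioo (0 : ℝ) 1, HasDerivAt (fun y => v₁ y - v₂ y) 0 y := by
    intro y hy
    have := (c₁ y hy).sub (c₂ y hy)
    rw [heq y hy, sub_self] at this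
    exact this
  have hconst : ∀ y ∈ Set.Ioo (0 : ℝ) 1, v₁ y - v₂ y = v₁ (1 / 2) - v₂ (1 / 2) := by
    intro y hy
    exact isOpen_Ioo.is_const_of_deriv_eq_zero (convex_Ioo (0 : ℝ) 1).isPreconnected
      (f := fun y => v₁ y - v₂ y)
      (fun x hx => (hder x hx).differentiableAt.differentiableWithinAt)
      (fun x hx => (hder x hx).deriv) hy (by norm_num)
  refine ⟨v₁ (1 / 2) - v₂ (1 / 2), fun s => ?_⟩
  have hy : u₂ s ∈ Set.Ioo (0 : ℝ) 1 := ⟨h₂.pos s, h₂.lt_one s⟩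
  have h3 := hconst _ hy
  rw [b₂ s] at h3
  rw [← h3]
  have : s + (v₁ (u₂ s) - s) = v₁ (u₂ s) := by ring
  rw [this, a₁ _ hy]

theorem LogSol.of_profile (n : ℕ) (Z : ℝ → ℝ)
    (hreg : ContDiffOn ℝ 2 Z (Set.Ioi (0 : ℝ)))
    (hrange : ∀ r > (0 : ℝ), Z r ∈ Set.Ioo (0 : ℝ) 1)
    (hsol : ∀ r > (0 : ℝ), bryantOp n Z r = 0)
    (hzero : Filter.Tendsto Z (nhdsWithin 0 (Set.Ioi 0)) (nhds 1))
    (hinfty : Filter.Tendsto Z Filter.atTop (nhds 0)) :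
    LogSol ((n : ℝ) - 1) (fun s => Z (Real.exp s)) (fun s => deriv Z (Real.exp s) * Real.exp s)
      (fun s => deriv (deriv Z) (Real.exp s) * Real.exp s * Real.exp s
        + deriv Z (Real.exp s) * Real.exp s) := by
  have hd1 : ∀ r > (0 : ℝ), HasDerivAt Z (deriv Z r) r := fun r hr =>
    ((hreg.differentiableOn (by norm_num)).differentiableAt (Ioi_mem_nhds hr)).hasDerivAt
  have hreg1 : ContDiffOn ℝ 1 (deriv Z) (Set.Ioi (0 : ℝ)) :=
    hreg.deriv_of_isOpen isOpen_Ioi (by norm_num)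
  have hd2 : ∀ r > (0 : ℝ), HasDerivAt (deriv Z) (deriv (deriv Z) r) r := fun r hr =>
    ((hreg1.differentiableOn (by norm_num)).differentiableAt (Ioi_mem_nhds hr)).hasDerivAt
  constructor
  · exact fun s => (hd1 _ (Real.exp_pos s)).comp s (Real.hasDerivAt_exp s)
  · exact fun s => ((hd2 _ (Real.exp_pos s)).comp s (Real.hasDerivAt_exp s)).mul
      (Real.hasDerivAt_exp s)
  · intro s
    have e := hsol _ (Real.exp_pos s)
    have hr := Real.exp_pos s
    unfold bryantOp at e
    generalize Real.exp s = r at *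
    have e2 := congrArg (fun x => x * r ^ 2) e
    simp only [zero_mul] at e2
    rw [← e2]
    field_simp
    ring
  · exact fun s => (hrange _ (Real.exp_pos s)).1
  · exact fun s => (hrange _ (Real.exp_pos s)).2
  · exact hzero.comp Real.tendsto_exp_atBot_nhdsGT
  · exact hinfty.comp Real.tendsto_exp_atTop

/-- The complete solutions of `F[Z] = 0` on `(0,∞)` taking values in `(0,1)` with
`Z(0⁺) = 1` and `Z(∞) = 0` form exactly a one-parameter family under rescaling:
any two such solutions are related by `Z₂(r) = Z₁(r/ρ)` for some `ρ > 0`. -/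
theorem bryant_soliton_profile_unique_up_to_scaling (n : ℕ) (hn : 2 ≤ n)
    (Z₁ Z₂ : ℝ → ℝ)
    (hreg₁ : ContDiffOn ℝ 2 Z₁ (Set.Ioi (0 : ℝ)))
    (hreg₂ : ContDiffOn ℝ 2 Z₂ (Set.Ioi (0 : ℝ)))
    (hrange₁ : ∀ r > (0 : ℝ), Z₁ r ∈ Set.Ioo (0 : ℝ) 1)
    (hrange₂ : ∀ r > (0 : ℝ), Z₂ r ∈ Set.Ioo (0 : ℝ) 1)
    (hsol₁ : ∀ r > (0 : ℝ), bryantOp n Z₁ r = 0)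
    (hsol₂ : ∀ r > (0 : ℝ), bryantOp n Z₂ r = 0)
    (hzero₁ : Filter.Tendsto Z₁ (nhdsWithin 0 (Set.Ioi 0)) (nhds 1))
    (hzero₂ : Filter.Tendsto Z₂ (nhdsWithin 0 (Set.Ioi 0)) (nhds 1))
    (hinfty₁ : Filter.Tendsto Z₁ Filter.atTop (nhds 0))
    (hinfty₂ : Filter.Tendsto Z₂ Filter.atTop (nhds 0)) :
    ∃ ρ > (0 : ℝ), ∀ r > (0 : ℝ), Z₂ r = Z₁ (r / ρ) := by
  have hm : (0 : ℝ) < (n : ℝ) - 1 := by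
    have : (2 : ℝ) ≤ n := by exact_mod_cast hn
    linarith
  obtain ⟨c, hc⟩ := LogSol.unique hm
    (LogSol.of_profile n Z₁ hreg₁ hrange₁ hsol₁ hzero₁ hinfty₁)
    (LogSol.of_profile n Z₂ hreg₂ hrange₂ hsol₂ hzero₂ hinfty₂)
  refine ⟨Real.exp (-c), Real.exp_pos _, fun r hr => ?_⟩
  have h := hc (Real.log r)
  simp only [Real.exp_add, Real.exp_log hr] at h
  rw [h, Real.exp_neg, div_inv_eq_mul]
end
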